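/- If h : ℝⁿ → ℝ is a nonconstant harmonic polynomial, then a point x ∈ Σ_h is a flat point of Σ_h (i.e. θ_{Σ_h}(x,r) → 0 as r → 0) if and only if Dh(x) ≠ 0. In particular, every flat point of the zero set of a harmonic polynomial is a regular point. -/

import Mathlib

open MvPolynomial Metric Filter
open scoped ENNReal

/-- Evaluate a multivariate polynomial at a point of Euclidean space. -/
noncomputable def evalPt {n : ℕ} (p : MvPolynomial (Fin n) ℝ)
    (y : EuclideanSpace ℝ (Fin n)) : ℝ :=
  MvPolynomial.eval (fun i => y i) p

/-- The zero set of a polynomial. -/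
def zeroSet {n : ℕ} (p : MvPolynomial (Fin n) ℝ) : Set (EuclideanSpace ℝ (Fin n)) :=
  {y | evalPt p y = 0}

/-- The polynomial y ↦ p(y + x). -/
noncomputable def translatePoly {n : ℕ} (p : MvPolynomial (Fin n) ℝ)
    (x : EuclideanSpace ℝ (Fin n)) : MvPolynomial (Fin n) ℝ :=
  MvPolynomial.bind₁ (fun i => MvPolynomial.X i + MvPolynomial.C (x i)) p

/-- The homogeneous part of degree `k` of `p` centered at `x`. -/
noncomputable def homPart {n : ℕ} (p : MvPolynomial (Fin n) ℝ)
    (x : EuclideanSpace ℝ (Fin n)) (k : ℕ) : MvPolynomial (Fin n) ℝ :=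
  MvPolynomial.homogeneousComponent k (translatePoly p x)

/-- The sup norm of |q| on the closed ball B(0,r), as an extended nonnegative real. -/
noncomputable def supNormBall {n : ℕ} (q : MvPolynomial (Fin n) ℝ) (r : ℝ) : ℝ≥0∞ :=
  ⨆ y ∈ Metric.closedBall (0 : EuclideanSpace ℝ (Fin n)) r, ENNReal.ofReal |evalPt q y|

/-- ζ_k(p,x,r): the relative size of the homogeneous part of degree k of a polynomial of
degree d, centered at x, on the ball of radius r. -/
noncomputable def zeta {n : ℕ} (d : ℕ) (p : MvPolynomial (Fin n) ℝ)
    (x : EuclideanSpace ℝ (Fin n)) (k : ℕ) (r : ℝ) : ℝ≥0∞ :=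
  ⨆ j ∈ (Finset.range (d + 1)).erase k,
    supNormBall (homPart p x j) r / supNormBall (homPart p x k) r

/-- A polynomial is harmonic if its Laplacian vanishes. -/
def IsHarmonic {n : ℕ} (p : MvPolynomial (Fin n) ℝ) : Prop :=
  ∑ i : Fin n, MvPolynomial.pderiv i (MvPolynomial.pderiv i p) = 0

/-- The local flatness θ_Σ(x,r): the normalized minimal Hausdorff distance between
Σ ∩ B(x,r) and (x + L) ∩ B(x,r) over hyperplanes L through the origin. -/
noncomputable def flatness {n : ℕ} (A : Set (EuclideanSpace ℝ (Fin n)))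
    (x : EuclideanSpace ℝ (Fin n)) (r : ℝ) : ℝ :=
  (1 / r) * ⨅ L : {L : Submodule ℝ (EuclideanSpace ℝ (Fin n)) // Module.finrank ℝ L = n - 1},
    Metric.hausdorffDist (A ∩ Metric.closedBall x r)
      (((fun y => x + y) '' (L.1 : Set (EuclideanSpace ℝ (Fin n)))) ∩ Metric.closedBall x r)

/-- Dp(x) ≠ 0 : some partial derivative of p is nonzero at x. -/
def gradNeZero {n : ℕ} (p : MvPolynomial (Fin n) ℝ) (x : EuclideanSpace ℝ (Fin n)) : Prop :=
  ∃ i : Fin n, MvPolynomial.eval (fun j => x j) (MvPolynomial.pderiv i p) ≠ 0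

/-- Sup of |h| on the unit sphere. -/
noncomputable def sphereSup {n : ℕ} (h : MvPolynomial (Fin n) ℝ) : ℝ :=
  sSup ((fun θ => |evalPt h θ|) '' Metric.sphere (0 : EuclideanSpace ℝ (Fin n)) 1)

/-- The polynomial y ↦ p(t·y). -/
noncomputable def dilatePoly {n : ℕ} (p : MvPolynomial (Fin n) ℝ) (t : ℝ) :
    MvPolynomial (Fin n) ℝ :=
  MvPolynomial.bind₁ (fun i => MvPolynomial.C t * MvPolynomial.X i) p

open MeasureTheory

/-! ### Gaussian integrals of polynomials -/

lemma integrable_pow_mul_gaussian (k : ℕ) :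
    Integrable fun t : ℝ => t ^ k * Real.exp (-(1 / 2) * t ^ 2) := by
  have hk : (-1 : ℝ) < (k : ℝ) := by
    have : (0 : ℝ) ≤ k := Nat.cast_nonneg k
    linarith
  simpa only [Real.rpow_natCast] using
    integrable_rpow_mul_exp_neg_mul_sq (b := 1 / 2) (by norm_num) hk

lemma integral_pow_succ_mul_gaussian (k : ℕ) :
    ∫ t : ℝ, t ^ (k + 1) * Real.exp (-(1 / 2) * t ^ 2) =
      k * ∫ t : ℝ, t ^ (k - 1) * Real.exp (-(1 / 2) * t ^ 2) := by
  have hu : ∀ t : ℝ, HasDerivAt (fun t : ℝ => t ^ k) (k * t ^ (k - 1)) t := fun t =>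
    hasDerivAt_pow k t
  have hv : ∀ t : ℝ, HasDerivAt (fun t : ℝ => -Real.exp (-(1 / 2) * t ^ 2))
      (t * Real.exp (-(1 / 2) * t ^ 2)) t := fun t => by
    have h := (((hasDerivAt_pow 2 t).const_mul (-(1 / 2) : ℝ)).exp).neg
    refine h.congr_deriv ?_
    push_cast
    ring
  have key := integral_mul_deriv_eq_deriv_mul_of_integrable
    (fun t _ => hu t) (fun t _ => hv t)
    (by
      refine (integrable_pow_mul_gaussian (k + 1)).congr (.of_forall fun t => ?_)
      simp only [Pi.mul_apply]
      ring)
    (by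
      refine ((integrable_pow_mul_gaussian (k - 1)).const_mul (-(k : ℝ))).congr
        (.of_forall fun t => ?_)
      simp only [Pi.mul_apply]
      ring)
    (by
      refine (integrable_pow_mul_gaussian k).neg.congr (.of_forall fun t => ?_)
      simp only [Pi.mul_apply, Pi.neg_apply]
      ring)
  rw [← integral_const_mul]
  calc _ = ∫ t : ℝ, t ^ k * (t * Real.exp (-(1 / 2) * t ^ 2)) := by
        congr 1; ext t; ring
    _ = _ := key
    _ = _ := by rw [← integral_neg]; congr 1; ext t; ring

/-- The integral of a polynomial against the weight `exp (-|y|² / 2)`. -/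
noncomputable def gaussInt {n : ℕ} (p : MvPolynomial (Fin n) ℝ) : ℝ :=
  ∫ y : Fin n → ℝ, eval y p * ∏ i, Real.exp (-(1 / 2) * y i ^ 2)

lemma eval_monomial_mul_gaussian {n : ℕ} (a : Fin n →₀ ℕ) (c : ℝ) (y : Fin n → ℝ) :
    eval y (monomial a c) * ∏ i, Real.exp (-(1 / 2) * y i ^ 2) =
      c * ∏ i, (y i ^ a i * Real.exp (-(1 / 2) * y i ^ 2)) := by
  rw [eval_monomial, Finsupp.prod_fintype _ _ (by simp), Finset.prod_mul_distrib, mul_assoc]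

lemma integrable_eval_mul_gaussian {n : ℕ} (p : MvPolynomial (Fin n) ℝ) :
    Integrable fun y : Fin n → ℝ => eval y p * ∏ i, Real.exp (-(1 / 2) * y i ^ 2) := by
  induction p using MvPolynomial.induction_on' with
  | monomial a c =>
    simp_rw [eval_monomial_mul_gaussian]
    exact (Integrable.fintype_prod fun i => integrable_pow_mul_gaussian (a i)).const_mul c
  | add p q hp hq =>
    simp_rw [map_add, add_mul]
    exact hp.add hq

lemma gaussInt_add {n : ℕ} (p q : MvPolynomial (Fin n) ℝ) :
    gaussInt (p + q) = gaussInt p + gaussInt q := by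
  simp_rw [gaussInt, map_add, add_mul]
  exact integral_add (integrable_eval_mul_gaussian p) (integrable_eval_mul_gaussian q)

lemma gaussInt_C_mul {n : ℕ} (c : ℝ) (p : MvPolynomial (Fin n) ℝ) :
    gaussInt (C c * p) = c * gaussInt p := by
  simp_rw [gaussInt, map_mul, eval_C, mul_assoc]
  exact integral_const_mul _ _

lemma gaussInt_zero {n : ℕ} : gaussInt (0 : MvPolynomial (Fin n) ℝ) = 0 := by
  simp [gaussInt]

lemma gaussInt_sum {n : ℕ} {ι : Type*} (s : Finset ι) (f : ι → MvPolynomial (Fin n) ℝ) :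
    gaussInt (∑ i ∈ s, f i) = ∑ i ∈ s, gaussInt (f i) := by
  classical
  induction s using Finset.induction_on with
  | empty => simp [gaussInt_zero]
  | insert a s ha ih => rw [Finset.sum_insert ha, Finset.sum_insert ha, gaussInt_add, ih]

lemma gaussInt_monomial {n : ℕ} (a : Fin n →₀ ℕ) (c : ℝ) :
    gaussInt (monomial a c) =
      c * ∏ i, ∫ t : ℝ, t ^ a i * Real.exp (-(1 / 2) * t ^ 2) := by
  simp_rw [gaussInt, eval_monomial_mul_gaussian]
  rw [integral_const_mul, integral_fintype_prod_volume_eq_prod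
    (fun i t => t ^ a i * Real.exp (-(1 / 2) * t ^ 2))]

lemma gaussInt_X_mul {n : ℕ} (i : Fin n) (p : MvPolynomial (Fin n) ℝ) :
    gaussInt (X i * p) = gaussInt (pderiv i p) := by
  induction p using MvPolynomial.induction_on' with
  | monomial a c =>
    have hX : (X i : MvPolynomial (Fin n) ℝ) * monomial a c =
        monomial (a + Finsupp.single i 1) c := by
      rw [X, monomial_mul, add_comm, one_mul]
    rw [hX, pderiv_monomial, gaussInt_monomial, gaussInt_monomial,
      ← Finset.mul_prod_erase _ _ (Finset.mem_univ i),
      ← Finset.mul_prod_erase _ _ (Finset.mem_univ i)]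
    have h1 : (a + Finsupp.single i 1 : Fin n →₀ ℕ) i = a i + 1 := by simp
    have h2 : (a - Finsupp.single i 1 : Fin n →₀ ℕ) i = a i - 1 := by simp
    rw [h1, h2, integral_pow_succ_mul_gaussian]
    have h3 : ∀ j ∈ Finset.univ.erase i,
        ∫ t : ℝ, t ^ (a + Finsupp.single i 1 : Fin n →₀ ℕ) j * Real.exp (-(1 / 2) * t ^ 2) =
        ∫ t : ℝ, t ^ (a - Finsupp.single i 1 : Fin n →₀ ℕ) j * Real.exp (-(1 / 2) * t ^ 2) := by
      intro j hj
      have hji : j ≠ i := Finset.ne_of_mem_erase hj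
      simp [hji]
    rw [Finset.prod_congr rfl h3]
    ring
  | add p q hp hq => rw [mul_add, map_add, gaussInt_add, gaussInt_add, hp, hq]

lemma eq_zero_of_gaussInt_eq_zero {n : ℕ} {p : MvPolynomial (Fin n) ℝ}
    (hp : ∀ y, 0 ≤ eval y p) (h0 : gaussInt p = 0) : p = 0 := by
  have hw : ∀ y : Fin n → ℝ, 0 < ∏ i, Real.exp (-(1 / 2) * y i ^ 2) := fun y =>
    Finset.prod_pos fun i _ => Real.exp_pos _
  have hae := (integral_eq_zero_iff_of_nonneg (fun y => mul_nonneg (hp y) (hw y).le)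
    (integrable_eval_mul_gaussian p)).1 h0
  have hc : Continuous fun y : Fin n → ℝ =>
      eval y p * ∏ i, Real.exp (-(1 / 2) * y i ^ 2) :=
    (MvPolynomial.continuous_eval p).mul (by fun_prop)
  have hz := (Continuous.ae_eq_iff_eq volume hc continuous_const).1 hae
  refine MvPolynomial.funext fun y => ?_
  rw [map_zero]
  exact (mul_eq_zero.1 (congrFun hz y)).resolve_right (hw y).ne'

/-! ### Homogeneous harmonic polynomials -/

lemma pderiv_comm_apply {n : ℕ} (i j : Fin n) (p : MvPolynomial (Fin n) ℝ) :
    pderiv i (pderiv j p) = pderiv j (pderiv i p) := by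
  ext m
  simp only [coeff_pderiv, add_right_comm m]
  rcases eq_or_ne i j with rfl | hij
  · rfl
  · simp [hij, hij.symm]
    ring

lemma IsHarmonic.pderiv {n : ℕ} {p : MvPolynomial (Fin n) ℝ} (hp : IsHarmonic p) (i : Fin n) :
    IsHarmonic (MvPolynomial.pderiv i p) := by
  have h := congrArg (MvPolynomial.pderiv i) hp
  rw [map_sum, map_zero] at h
  rw [IsHarmonic, ← h]
  refine Finset.sum_congr rfl fun j _ => ?_
  rw [pderiv_comm_apply j i p, pderiv_comm_apply i j (MvPolynomial.pderiv j p)]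

lemma pderiv_homogeneousComponent {n : ℕ} (i : Fin n) (k : ℕ) (p : MvPolynomial (Fin n) ℝ) :
    pderiv i (homogeneousComponent (k + 1) p) = homogeneousComponent k (pderiv i p) := by
  ext m
  simp only [coeff_pderiv, coeff_homogeneousComponent]
  simp [Finsupp.degree_single]

lemma IsHarmonic.homogeneousComponent {n : ℕ} {p : MvPolynomial (Fin n) ℝ} (hp : IsHarmonic p)
    (k : ℕ) : IsHarmonic (MvPolynomial.homogeneousComponent k p) := by
  rw [IsHarmonic] at *
  match k with
  | 0 => simp
  | 1 => simp [pderiv_homogeneousComponent]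
  | k + 2 =>
    simp_rw [pderiv_homogeneousComponent]
    rw [← map_sum, hp, map_zero]

lemma isHomogeneous_pderiv {n k : ℕ} {p : MvPolynomial (Fin n) ℝ} (hp : p.IsHomogeneous (k + 1))
    (i : Fin n) : (pderiv i p).IsHomogeneous k := by
  rw [← homogeneousComponent_eq_self hp, pderiv_homogeneousComponent]
  exact homogeneousComponent_isHomogeneous _ _

lemma gaussInt_eq_zero_of_isHarmonic {n k : ℕ} {p : MvPolynomial (Fin n) ℝ}
    (hp : p.IsHomogeneous k) (hk : k ≠ 0) (hh : IsHarmonic p) : gaussInt p = 0 := by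
  have h := congrArg gaussInt hp.sum_X_mul_pderiv
  simp_rw [gaussInt_sum, gaussInt_X_mul] at h
  rw [← gaussInt_sum, show ∑ i, MvPolynomial.pderiv i (MvPolynomial.pderiv i p) = 0 from hh,
    gaussInt_zero, nsmul_eq_mul, ← map_natCast (C : ℝ →+* MvPolynomial (Fin n) ℝ),
    gaussInt_C_mul] at h
  have : (k : ℝ) ≠ 0 := Nat.cast_ne_zero.2 hk
  simpa [this] using h.symm

lemma gaussInt_linear_mul_eq_zero {n k : ℕ} {p : MvPolynomial (Fin n) ℝ}
    (hp : p.IsHomogeneous k) (hk : 2 ≤ k) (hh : IsHarmonic p) (v : Fin n → ℝ) :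
    gaussInt ((∑ i, C (v i) * X i) * p) = 0 := by
  obtain ⟨k, rfl⟩ : ∃ l, k = l + 1 := ⟨k - 1, by omega⟩
  rw [Finset.sum_mul, gaussInt_sum]
  refine Finset.sum_eq_zero fun i _ => ?_
  rw [mul_assoc, gaussInt_C_mul, gaussInt_X_mul,
    gaussInt_eq_zero_of_isHarmonic (isHomogeneous_pderiv hp i) (by omega) (hh.pderiv i), mul_zero]

lemma eval_smul_of_isHomogeneous {n k : ℕ} {p : MvPolynomial (Fin n) ℝ} (hp : p.IsHomogeneous k)
    (t : ℝ) (y : Fin n → ℝ) : eval (t • y) p = t ^ k * eval y p := by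
  rw [eval_eq', eval_eq', Finset.mul_sum]
  refine Finset.sum_congr rfl fun d hd => ?_
  have hdk : ∑ i, d i = k := by
    rw [← Finsupp.degree_eq_sum]
    by_contra hne
    exact mem_support_iff.1 hd (hp.coeff_eq_zero hne)
  simp only [Pi.smul_apply, smul_eq_mul, mul_pow, Finset.prod_mul_distrib,
    Finset.prod_pow_eq_pow_sum, hdk]
  ring

lemma eval_translatePoly {n : ℕ} (p : MvPolynomial (Fin n) ℝ) (x : EuclideanSpace ℝ (Fin n))
    (y : Fin n → ℝ) : eval y (translatePoly p x) = eval (fun i => y i + x i) p := by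
  rw [translatePoly, ← MvPolynomial.coe_aeval_eq_eval, ← MvPolynomial.coe_aeval_eq_eval]
  change aeval y (bind₁ _ p) = aeval _ p
  rw [aeval_bind₁]
  simp

lemma pderiv_translatePoly {n : ℕ} (p : MvPolynomial (Fin n) ℝ) (x : EuclideanSpace ℝ (Fin n))
    (i : Fin n) : pderiv i (translatePoly p x) = translatePoly (pderiv i p) x := by
  unfold translatePoly
  induction p using MvPolynomial.induction_on with
  | C a => simp
  | add p q hp hq => simp [hp, hq]
  | mul_X p j hp =>
    simp only [map_mul, bind₁_X_right, pderiv_mul, hp, map_add, pderiv_C, add_zero]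
    rcases eq_or_ne i j with rfl | hij
    · simp
    · simp [pderiv_X_of_ne hij.symm]

lemma IsHarmonic.translatePoly {n : ℕ} {p : MvPolynomial (Fin n) ℝ} (hp : IsHarmonic p)
    (x : EuclideanSpace ℝ (Fin n)) : IsHarmonic (_root_.translatePoly p x) := by
  rw [IsHarmonic] at *
  simp_rw [pderiv_translatePoly]
  simp only [_root_.translatePoly] at *
  rw [← map_sum, hp, map_zero]

lemma homPart_one_eq_zero {n : ℕ} {p : MvPolynomial (Fin n) ℝ} {x : EuclideanSpace ℝ (Fin n)}
    (hx : ¬ gradNeZero p x) : homPart p x 1 = 0 := by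
  rw [gradNeZero] at hx
  push Not at hx
  ext d
  rw [homPart, coeff_homogeneousComponent, coeff_zero]
  split_ifs with hd
  · obtain ⟨i, rfl⟩ : ∃ i, d = Finsupp.single i 1 := by
      exact (Finsupp.sum_eq_one_iff d).1 hd
    have h1 := coeff_pderiv (i := i) (translatePoly p x) 0
    have h2 := eval_translatePoly (pderiv i p) x 0
    simp [hx i, eval_zero, constantCoeff_eq, ← pderiv_translatePoly] at h2
    simpa [h2] using h1.symm
  · rfl

/-! ### Taylor expansion at a point -/

lemma continuous_evalPt {n : ℕ} (p : MvPolynomial (Fin n) ℝ) : Continuous (evalPt p) :=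
  (MvPolynomial.continuous_eval p).comp (PiLp.continuous_ofLp 2 _)

lemma evalPt_smul_of_isHomogeneous {n k : ℕ} {p : MvPolynomial (Fin n) ℝ}
    (hp : p.IsHomogeneous k) (t : ℝ) (y : EuclideanSpace ℝ (Fin n)) :
    evalPt p (t • y) = t ^ k * evalPt p y :=
  eval_smul_of_isHomogeneous hp t y

lemma evalPt_add_smul_eq_sum {n : ℕ} (p : MvPolynomial (Fin n) ℝ)
    (x a : EuclideanSpace ℝ (Fin n)) (t : ℝ) :
    evalPt p (x + t • a) =
      ∑ j ∈ Finset.range ((translatePoly p x).totalDegree + 1),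
        t ^ j * evalPt (homPart p x j) a := by
  have h1 : evalPt p (x + t • a) = evalPt (translatePoly p x) (t • a) := by
    rw [evalPt, evalPt, eval_translatePoly]
    simp [add_comm]
  rw [h1]
  conv_lhs => rw [← sum_homogeneousComponent (φ := translatePoly p x)]
  rw [evalPt, map_sum]
  exact Finset.sum_congr rfl fun j _ =>
    evalPt_smul_of_isHomogeneous (homogeneousComponent_isHomogeneous j _) t a

lemma tendsto_evalPt_div_pow {n k : ℕ} {p : MvPolynomial (Fin n) ℝ}
    {x : EuclideanSpace ℝ (Fin n)} (hk : ∀ j < k, homPart p x j = 0)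
    (a : EuclideanSpace ℝ (Fin n)) :
    Tendsto (fun t : ℝ => evalPt p (x + t • a) / t ^ k) (nhdsWithin 0 (Set.Ioi 0))
      (nhds (evalPt (homPart p x k) a)) := by
  set D := (translatePoly p x).totalDegree
  let F : ℝ → ℝ := fun t =>
    ∑ j ∈ Finset.range (D + 1), t ^ (j - k) * evalPt (homPart p x j) a
  have hF : Continuous F := by fun_prop
  have hterm : ∀ j < k, evalPt (homPart p x j) a = 0 := fun j hj => by
    rw [hk j hj, evalPt, map_zero]
  have hF0 : F 0 = evalPt (homPart p x k) a := by
    rw [show F 0 = ∑ j ∈ Finset.range (D + 1), (0 : ℝ) ^ (j - k) * evalPt (homPart p x j) a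
      from rfl, Finset.sum_eq_single k]
    · simp
    · intro j _ hj
      rcases lt_or_gt_of_ne hj with h | h
      · rw [hterm j h, mul_zero]
      · rw [zero_pow (by omega), zero_mul]
    · intro h
      rw [homPart, homogeneousComponent_eq_zero k _ (by simpa [D] using h), evalPt, map_zero,
        mul_zero]
  rw [← hF0]
  refine Tendsto.congr' ?_ ((hF.tendsto 0).mono_left nhdsWithin_le_nhds)
  filter_upwards [self_mem_nhdsWithin] with t ht
  have ht : t ≠ 0 := (Set.mem_Ioi.1 ht).ne'
  rw [evalPt_add_smul_eq_sum, Finset.sum_div]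
  refine Finset.sum_congr rfl fun j _ => ?_
  rcases lt_or_ge j k with h | h
  · simp [hterm j h]
  · rw [mul_div_right_comm, pow_sub₀ t ht h, div_eq_mul_inv]

lemma exists_homPart_ne_zero {n : ℕ} {p : MvPolynomial (Fin n) ℝ} (hp : p.totalDegree ≠ 0)
    (x : EuclideanSpace ℝ (Fin n)) : ∃ k, homPart p x k ≠ 0 := by
  by_contra! h
  have hT : translatePoly p x = 0 := by
    rw [← sum_homogeneousComponent (φ := translatePoly p x)]
    exact Finset.sum_eq_zero fun j _ => h j
  apply hp
  have : p = 0 := MvPolynomial.funext fun y => by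
    have := eval_translatePoly p x (fun i => y i - x i)
    simpa [hT] using this.symm
  rw [this, totalDegree_zero]

lemma homPart_zero_eq_zero {n : ℕ} {p : MvPolynomial (Fin n) ℝ} {x : EuclideanSpace ℝ (Fin n)}
    (hx : x ∈ zeroSet p) : homPart p x 0 = 0 := by
  have h := eval_translatePoly p x 0
  have hx' : eval (fun i => x i) p = 0 := hx
  simp only [Pi.zero_apply, zero_add, hx', eval_zero] at h
  rw [homPart, homogeneousComponent_zero, ← constantCoeff_eq, h, map_zero]

/-! ### Flat points are regular -/

lemma finrank_orthogonal_span_singleton_eq {n : ℕ} {v : EuclideanSpace ℝ (Fin n)} (hv : v ≠ 0) :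
    Module.finrank ℝ (ℝ ∙ v)ᗮ = n - 1 := by
  have h1 := Submodule.finrank_add_finrank_orthogonal (𝕜 := ℝ) (ℝ ∙ v)
  rw [finrank_span_singleton hv, finrank_euclideanSpace_fin] at h1
  omega

lemma nonempty_hyperplanes {n : ℕ} (hn : n ≠ 0) :
    Nonempty {L : Submodule ℝ (EuclideanSpace ℝ (Fin n)) // Module.finrank ℝ L = n - 1} := by
  have : Nonempty (Fin n) := ⟨⟨0, Nat.pos_of_ne_zero hn⟩⟩
  obtain ⟨v, hv⟩ := exists_ne (0 : EuclideanSpace ℝ (Fin n))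
  exact ⟨⟨_, finrank_orthogonal_span_singleton_eq hv⟩⟩

lemma flatness_nonneg {n : ℕ} (A : Set (EuclideanSpace ℝ (Fin n)))
    (x : EuclideanSpace ℝ (Fin n)) {r : ℝ} (hr : 0 ≤ r) : 0 ≤ flatness A x r :=
  mul_nonneg (by positivity) (Real.iInf_nonneg fun _ => hausdorffDist_nonneg)

lemma exists_normal_of_flatness_lt {n : ℕ} (hn : n ≠ 0) {A : Set (EuclideanSpace ℝ (Fin n))}
    {x : EuclideanSpace ℝ (Fin n)} (hx : x ∈ A) {r ε : ℝ} (hr : 0 < r)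
    (hε : flatness A x r < ε) :
    ∃ v : EuclideanSpace ℝ (Fin n), ‖v‖ = 1 ∧
      ∀ y ∈ A ∩ closedBall x r, |inner ℝ v (y - x)| ≤ ε * r := by
  have := nonempty_hyperplanes hn
  rw [flatness, one_div, inv_mul_lt_iff₀ hr] at hε
  obtain ⟨⟨L, hL⟩, hLε⟩ := exists_lt_of_ciInf_lt hε
  have hLtop : L ≠ ⊤ := by
    rintro rfl
    rw [finrank_top, finrank_euclideanSpace_fin] at hL
    omega
  obtain ⟨w, hw, hw0⟩ := Submodule.exists_mem_ne_zero_of_ne_bot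
    (mt (Submodule.orthogonal_eq_bot_iff).1 hLtop)
  refine ⟨‖w‖⁻¹ • w, norm_smul_inv_norm hw0, fun y hy => ?_⟩
  have hfin : hausdorffEDist (A ∩ closedBall x r)
      (((fun y => x + y) '' (L : Set (EuclideanSpace ℝ (Fin n)))) ∩ closedBall x r) ≠ ⊤ :=
    hausdorffEDist_ne_top_of_nonempty_of_bounded ⟨x, hx, mem_closedBall_self hr.le⟩
      ⟨x, ⟨0, L.zero_mem, add_zero x⟩, mem_closedBall_self hr.le⟩
      (isBounded_closedBall.subset Set.inter_subset_right)
      (isBounded_closedBall.subset Set.inter_subset_right)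
  obtain ⟨_, ⟨⟨l, hl, rfl⟩, -⟩, hdist⟩ := exists_dist_lt_of_hausdorffDist_lt hy hLε hfin
  have hwl : inner ℝ w l = 0 := Submodule.inner_left_of_mem_orthogonal hl hw
  have heq : inner ℝ (‖w‖⁻¹ • w) (y - x) = inner ℝ (‖w‖⁻¹ • w) (y - (x + l)) := by
    rw [← sub_sub, inner_sub_right _ (y - x) l, inner_smul_left _ l, hwl, mul_zero, sub_zero]
  rw [heq]
  refine (abs_real_inner_le_norm _ _).trans ?_
  rw [show ‖‖w‖⁻¹ • w‖ = 1 from norm_smul_inv_norm hw0, one_mul, ← dist_eq_norm]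
  exact (hdist.trans_eq (mul_comm _ _)).le

lemma lt_abs_convex_combination {α β c s : ℝ} (hα : |α| ≤ 1) (hβ : |β| ≤ 1) (h : c < α * β)
    (hc : 0 < c) (hs0 : 0 ≤ s) (hs1 : s ≤ 1) : c < |α + s * (β - α)| := by
  rw [abs_le] at hα hβ
  rcases pos_and_pos_or_neg_and_neg_of_mul_pos (hc.trans h) with ⟨h1, h2⟩ | ⟨h1, h2⟩
  · refine lt_of_lt_of_le ?_ (le_abs_self _)
    have h3 : c < α := by nlinarith
    have h4 : c < β := by nlinarith
    obtain ⟨m, hcm, hm⟩ := exists_between (lt_min h3 h4)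
    have h5 := lt_min_iff.1 hm
    nlinarith [mul_nonneg (sub_nonneg.2 hs1) (sub_nonneg.2 h5.1.le),
      mul_nonneg hs0 (sub_nonneg.2 h5.2.le)]
  · refine lt_of_lt_of_le ?_ (neg_le_abs _)
    have h3 : c < -α := by nlinarith
    have h4 : c < -β := by nlinarith
    obtain ⟨m, hcm, hm⟩ := exists_between (lt_min h3 h4)
    have h5 := lt_min_iff.1 hm
    nlinarith [mul_nonneg (sub_nonneg.2 hs1) (sub_nonneg.2 h5.1.le),
      mul_nonneg hs0 (sub_nonneg.2 h5.2.le)]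

lemma exists_normal_of_tendsto_flatness {n k : ℕ} (hn : n ≠ 0) {p : MvPolynomial (Fin n) ℝ}
    {x : EuclideanSpace ℝ (Fin n)} (hx : x ∈ zeroSet p)
    (hflat : Tendsto (fun r => flatness (zeroSet p) x r) (nhdsWithin 0 (Set.Ioi 0)) (nhds 0))
    (hk : ∀ j < k, homPart p x j = 0) :
    ∃ ν : EuclideanSpace ℝ (Fin n), ν ≠ 0 ∧ ∀ a b, 0 < evalPt (homPart p x k) a →
      evalPt (homPart p x k) b < 0 → inner ℝ ν a * inner ℝ ν b ≤ 0 := by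
  have hex : ∀ r : ℝ, 0 < r → ∃ v : EuclideanSpace ℝ (Fin n), ‖v‖ = 1 ∧
      ∀ y ∈ zeroSet p ∩ closedBall x r,
        |inner ℝ v (y - x)| ≤ (flatness (zeroSet p) x r + r) * r := fun r hr =>
    exists_normal_of_flatness_lt hn hx hr (lt_add_of_pos_right _ hr)
  choose! v hv1 hv using hex
  obtain ⟨ν, hν, hcl⟩ := (isCompact_sphere (0 : EuclideanSpace ℝ (Fin n)) 1).exists_mapClusterPt
    (f := nhdsWithin 0 (Set.Ioi (0 : ℝ))) (u := v) (by
      refine tendsto_principal.2 ?_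
      filter_upwards [self_mem_nhdsWithin] with r hr
      exact mem_sphere_zero_iff_norm.2 (hv1 r hr))
  have key : ∀ a b : EuclideanSpace ℝ (Fin n), ‖a‖ ≤ 1 → ‖b‖ ≤ 1 →
      0 < evalPt (homPart p x k) a → evalPt (homPart p x k) b < 0 →
      inner ℝ ν a * inner ℝ ν b ≤ 0 := by
    intro a b ha hb hqa hqb
    by_contra! hab
    obtain ⟨c, hc0, hc⟩ := exists_between hab
    have hU : ∀ᶠ w in nhds ν, c < inner ℝ w a * inner ℝ w b := by
      have : Continuous fun w : EuclideanSpace ℝ (Fin n) => inner ℝ w a * inner ℝ w b := by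
        fun_prop
      exact this.continuousAt.eventually_const_lt hc
    have hfreq := hcl.frequently hU
    have hsum : Tendsto (fun r => flatness (zeroSet p) x r + r) (nhdsWithin 0 (Set.Ioi 0))
        (nhds (0 + 0)) := hflat.add nhdsWithin_le_nhds
    rw [add_zero] at hsum
    obtain ⟨r, hrc, hr0, hrs, hra, hrb⟩ := (hfreq.and_eventually
      (Filter.Eventually.and self_mem_nhdsWithin
      ((hsum.eventually_lt_const hc0).and
      (((tendsto_evalPt_div_pow hk a).eventually_const_lt hqa).and
      ((tendsto_evalPt_div_pow hk b).eventually_lt_const hqb))))).exists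
    have hr0 : 0 < r := hr0
    have hpa : 0 < evalPt p (x + r • a) := by
      simpa [hr0] using (div_pos_iff_of_pos_right (pow_pos hr0 k)).1 hra
    have hpb : evalPt p (x + r • b) < 0 := by
      by_contra! h
      exact absurd hrb (not_lt.2 (by positivity))
    have hcont : Continuous fun s : ℝ => evalPt p (x + r • (a + s • (b - a))) :=
      (continuous_evalPt p).comp (by fun_prop)
    obtain ⟨s, ⟨hs0, hs1⟩, hs⟩ := intermediate_value_Icc' (zero_le_one' ℝ) hcont.continuousOn
      (show (0 : ℝ) ∈ Set.Icc _ _ by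
        simp only [one_smul, zero_smul, add_zero, add_sub_cancel]
        exact ⟨hpb.le, hpa.le⟩)
    have hz : ‖a + s • (b - a)‖ ≤ 1 := by
      have : a + s • (b - a) = (1 - s) • a + s • b := by module
      rw [this]
      refine (norm_add_le _ _).trans ?_
      rw [norm_smul, norm_smul, Real.norm_of_nonneg hs0, Real.norm_of_nonneg (by linarith)]
      nlinarith
    have hmem : x + r • (a + s • (b - a)) ∈ zeroSet p ∩ closedBall x r := by
      refine ⟨hs, ?_⟩
      rw [mem_closedBall, dist_self_add_left, norm_smul, Real.norm_of_nonneg hr0.le]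
      nlinarith
    have hle := hv r hr0 _ hmem
    rw [add_sub_cancel_left, inner_smul_right, abs_mul, abs_of_pos hr0, mul_comm,
      mul_le_mul_iff_left₀ hr0, inner_add_right, inner_smul_right, inner_sub_right] at hle
    have hbd : ∀ w : EuclideanSpace ℝ (Fin n), ‖w‖ ≤ 1 → |inner ℝ (v r) w| ≤ 1 := fun w hw => by
      refine (abs_real_inner_le_norm _ _).trans ?_
      rwa [hv1 r hr0, one_mul]
    exact absurd hle (not_le.2 (hrs.trans
      (lt_abs_convex_combination (hbd a ha) (hbd b hb) hrc hc0 hs0 hs1)))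
  refine ⟨ν, ne_zero_of_mem_unit_sphere ⟨ν, hν⟩, fun a b hqa hqb => ?_⟩
  obtain ⟨R, hR⟩ : ∃ R : ℝ, R = 1 + ‖a‖ + ‖b‖ := ⟨_, rfl⟩
  have hR0 : 0 < R := by rw [hR]; positivity
  have hscale : ∀ w, evalPt (homPart p x k) (R⁻¹ • w) = R⁻¹ ^ k * evalPt (homPart p x k) w :=
    evalPt_smul_of_isHomogeneous (homogeneousComponent_isHomogeneous k _) _
  have hnorm : ∀ w : EuclideanSpace ℝ (Fin n), ‖w‖ ≤ R → ‖R⁻¹ • w‖ ≤ 1 := fun w hw => by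
    rw [norm_smul, norm_inv, Real.norm_of_nonneg hR0.le, inv_mul_le_iff₀ hR0, mul_one]
    exact hw
  have h := key (R⁻¹ • a) (R⁻¹ • b) (hnorm a (by linarith [norm_nonneg b]))
    (hnorm b (by linarith [norm_nonneg a])) (by rw [hscale]; positivity)
    (by rw [hscale]; exact mul_neg_of_pos_of_neg (by positivity) hqb)
  rw [inner_smul_right, inner_smul_right, mul_mul_mul_comm] at h
  exact nonpos_of_mul_nonpos_right h (by positivity)

lemma evalPt_nonneg_of_inner_ne_zero {n : ℕ} {q : MvPolynomial (Fin n) ℝ}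
    {ν : EuclideanSpace ℝ (Fin n)} (hν : ν ≠ 0)
    (h : ∀ y, inner ℝ ν y ≠ 0 → 0 ≤ evalPt q y) (y : EuclideanSpace ℝ (Fin n)) :
    0 ≤ evalPt q y := by
  by_cases hy : inner ℝ ν y = 0
  · have hc : Continuous fun t : ℝ => evalPt q (y + t • ν) :=
      (continuous_evalPt q).comp (by fun_prop)
    have ht := (hc.tendsto 0).mono_left (nhdsWithin_le_nhds (s := Set.Ioi 0))
    simp only [zero_smul, add_zero] at ht
    refine ge_of_tendsto ht ?_
    filter_upwards [self_mem_nhdsWithin] with t ht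
    refine h _ ?_
    rw [inner_add_right, hy, zero_add, inner_smul_right]
    exact mul_ne_zero (ne_of_gt ht) (inner_self_ne_zero.2 hν)
  · exact h y hy

lemma eq_zero_of_isHarmonic_of_evalPt_nonneg {n k : ℕ} {q : MvPolynomial (Fin n) ℝ}
    (hq : q.IsHomogeneous k) (hk : k ≠ 0) (hh : IsHarmonic q) (h : ∀ y, 0 ≤ evalPt q y) :
    q = 0 :=
  eq_zero_of_gaussInt_eq_zero (fun y => h (WithLp.toLp 2 y))
    (gaussInt_eq_zero_of_isHarmonic hq hk hh)

lemma eq_zero_of_isHarmonic_of_inner_mul_nonneg {n k : ℕ} {q : MvPolynomial (Fin n) ℝ}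
    (hq : q.IsHomogeneous k) (hk : 2 ≤ k) (hh : IsHarmonic q)
    {ν : EuclideanSpace ℝ (Fin n)} (hν : ν ≠ 0) (h : ∀ y, 0 ≤ inner ℝ ν y * evalPt q y) :
    q = 0 := by
  have hl : ∀ y, eval y (∑ i, C (ν i) * X i) = inner ℝ ν (WithLp.toLp 2 y) := fun y => by
    simp [PiLp.inner_apply, mul_comm]
  have h0 : (∑ i, C (ν i) * X i) * q = 0 :=
    eq_zero_of_gaussInt_eq_zero
      (fun y => by rw [map_mul, hl]; exact h (WithLp.toLp 2 y))
      (gaussInt_linear_mul_eq_zero hq hk hh ν)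
  refine (mul_eq_zero.1 h0).resolve_left fun hl0 => ?_
  have := hl ν
  rw [hl0, map_zero] at this
  exact inner_self_ne_zero.2 hν this.symm

lemma IsHarmonic.neg {n : ℕ} {p : MvPolynomial (Fin n) ℝ} (hp : IsHarmonic p) :
    IsHarmonic (-p) := by
  rw [IsHarmonic] at *
  simp [hp]

lemma eq_zero_of_isHarmonic_of_sign_on_half_spaces {n k : ℕ} {q : MvPolynomial (Fin n) ℝ}
    (hq : q.IsHomogeneous k) (hk : 2 ≤ k) (hh : IsHarmonic q)
    {ν : EuclideanSpace ℝ (Fin n)} (hν : ν ≠ 0)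
    (h : ∀ a b, 0 < evalPt q a → evalPt q b < 0 → inner ℝ ν a * inner ℝ ν b ≤ 0) : q = 0 := by
  have hneg : ∀ y, evalPt (-q) y = -evalPt q y := fun y => map_neg _ _
  have hk0 : k ≠ 0 := by omega
  by_cases h1 : ∃ a, 0 < evalPt q a ∧ 0 < inner ℝ ν a
  · obtain ⟨a, hqa, ha⟩ := h1
    have hpos : ∀ y, 0 < inner ℝ ν y → 0 ≤ evalPt q y := fun y hy => by
      by_contra! hqy
      exact absurd (h a y hqa hqy) (not_le.2 (mul_pos ha hy))
    by_cases h2 : ∃ b, evalPt q b < 0 ∧ inner ℝ ν b < 0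
    · obtain ⟨b, hqb, hb⟩ := h2
      refine eq_zero_of_isHarmonic_of_inner_mul_nonneg hq hk hh hν fun y => ?_
      rcases lt_trichotomy (inner ℝ ν y) 0 with hy | hy | hy
      · refine mul_nonneg_of_nonpos_of_nonpos hy.le (not_lt.1 fun hqy => ?_)
        exact absurd (h y b hqy hqb) (not_le.2 (mul_pos_of_neg_of_neg hy hb))
      · rw [hy, zero_mul]
      · exact mul_nonneg hy.le (hpos y hy)
    · push Not at h2
      refine eq_zero_of_isHarmonic_of_evalPt_nonneg hq hk0 hh
        (evalPt_nonneg_of_inner_ne_zero hν fun y hy => ?_)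
      rcases lt_or_gt_of_ne hy with hy | hy
      · exact not_lt.1 fun hqy => absurd (h2 y hqy) (not_le.2 hy)
      · exact hpos y hy
  · push Not at h1
    have hnonpos : ∀ y, 0 < inner ℝ ν y → evalPt q y ≤ 0 := fun y hy =>
      not_lt.1 fun hqy => absurd (h1 y hqy) (not_le.2 hy)
    rw [← neg_eq_zero]
    by_cases h2 : ∃ a, 0 < evalPt q a ∧ inner ℝ ν a < 0
    · obtain ⟨a, hqa, ha⟩ := h2
      refine eq_zero_of_isHarmonic_of_inner_mul_nonneg hq.neg hk hh.neg hν fun y => ?_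
      rw [hneg]
      rcases lt_trichotomy (inner ℝ ν y) 0 with hy | hy | hy
      · refine mul_nonneg_of_nonpos_of_nonpos hy.le (neg_nonpos.2 (not_lt.1 fun hqy => ?_))
        exact absurd (h a y hqa hqy) (not_le.2 (mul_pos_of_neg_of_neg ha hy))
      · rw [hy, zero_mul]
      · exact mul_nonneg hy.le (neg_nonneg.2 (hnonpos y hy))
    · push Not at h2
      refine eq_zero_of_isHarmonic_of_evalPt_nonneg hq.neg hk0 hh.neg
        (evalPt_nonneg_of_inner_ne_zero hν fun y hy => ?_)
      rw [hneg, neg_nonneg]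
      rcases lt_or_gt_of_ne hy with hy | hy
      · exact not_lt.1 fun hqy => absurd (h2 y hqy) (not_le.2 hy)
      · exact hnonpos y hy

lemma gradNeZero_of_tendsto_flatness {n : ℕ} (hn : n ≠ 0) {h : MvPolynomial (Fin n) ℝ}
    (hharm : IsHarmonic h) (hnc : h.totalDegree ≠ 0) {x : EuclideanSpace ℝ (Fin n)}
    (hx : x ∈ zeroSet h)
    (hflat : Tendsto (fun r => flatness (zeroSet h) x r) (nhdsWithin 0 (Set.Ioi 0)) (nhds 0)) :
    gradNeZero h x := by
  classical
  by_contra hgrad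
  have hex := exists_homPart_ne_zero hnc x
  have hk2 : 2 ≤ Nat.find hex := by
    by_contra! hlt
    have hne := Nat.find_spec hex
    interval_cases Nat.find hex
    · exact hne (homPart_zero_eq_zero hx)
    · exact hne (homPart_one_eq_zero hgrad)
  obtain ⟨ν, hν, hsign⟩ := exists_normal_of_tendsto_flatness (k := Nat.find hex) hn hx hflat
    fun j hj => not_not.1 (Nat.find_min hex hj)
  exact Nat.find_spec hex (eq_zero_of_isHarmonic_of_sign_on_half_spaces
    (homogeneousComponent_isHomogeneous _ _) hk2
    ((hharm.translatePoly x).homogeneousComponent _) hν hsign)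

/-! ### Regular points are flat -/

/-- The gradient of a polynomial at a point. -/
noncomputable def polyGradient {n : ℕ} (p : MvPolynomial (Fin n) ℝ)
    (x : EuclideanSpace ℝ (Fin n)) : EuclideanSpace ℝ (Fin n) :=
  WithLp.toLp 2 fun i => evalPt (pderiv i p) x

lemma hasFDerivAt_evalPt {n : ℕ} (p : MvPolynomial (Fin n) ℝ)
    (x : EuclideanSpace ℝ (Fin n)) :
    HasFDerivAt (evalPt p) (innerSL ℝ (polyGradient p x)) x := by
  induction p using MvPolynomial.induction_on with
  | C a =>
    have h0 : polyGradient (C a) x = 0 := by ext i; simp [polyGradient, evalPt]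
    have hf : evalPt (C a : MvPolynomial (Fin n) ℝ) = fun _ => a := by ext y; simp [evalPt]
    rw [h0, hf, map_zero]
    exact hasFDerivAt_const a x
  | add p q hp hq =>
    have h0 : polyGradient (p + q) x = polyGradient p x + polyGradient q x := by
      ext i; simp [polyGradient, evalPt]
    have hf : evalPt (p + q) = evalPt p + evalPt q := by ext y; simp [evalPt]
    rw [h0, hf, map_add]
    exact hp.add hq
  | mul_X p i hp =>
    have hX : HasFDerivAt (fun y : EuclideanSpace ℝ (Fin n) => y i)
        (EuclideanSpace.proj i : EuclideanSpace ℝ (Fin n) →L[ℝ] ℝ) x :=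
      (EuclideanSpace.proj i : EuclideanSpace ℝ (Fin n) →L[ℝ] ℝ).hasFDerivAt
    have hf : evalPt (p * X i) = evalPt p * fun y => y i := by ext y; simp [evalPt]
    rw [hf]
    refine (hp.mul hX).congr_fderiv ?_
    have h0 : polyGradient (p * X i) x =
        x i • polyGradient p x + evalPt p x • EuclideanSpace.single i 1 := by
      ext j
      rcases eq_or_ne j i with rfl | hj
      · simp [polyGradient, evalPt]
        ring
      · simp [polyGradient, evalPt, hj]
    ext y
    rw [h0]
    simp [EuclideanSpace.inner_single_left]
    ring

lemma polyGradient_ne_zero {n : ℕ} {p : MvPolynomial (Fin n) ℝ}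
    {x : EuclideanSpace ℝ (Fin n)} (h : gradNeZero p x) : polyGradient p x ≠ 0 := by
  obtain ⟨i, hi⟩ := h
  intro h0
  exact hi (congrArg (fun v : EuclideanSpace ℝ (Fin n) => v i) h0)

lemma flatness_le_of_hausdorffDist_le {n : ℕ} {A : Set (EuclideanSpace ℝ (Fin n))}
    {x : EuclideanSpace ℝ (Fin n)} {r c : ℝ} (hr : 0 < r)
    {L : Submodule ℝ (EuclideanSpace ℝ (Fin n))} (hL : Module.finrank ℝ L = n - 1)
    (h : hausdorffDist (A ∩ closedBall x r)
      (((fun y => x + y) '' (L : Set (EuclideanSpace ℝ (Fin n)))) ∩ closedBall x r) ≤ c * r) :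
    flatness A x r ≤ c := by
  rw [flatness, one_div, inv_mul_le_iff₀ hr, mul_comm r c]
  refine le_trans (ciInf_le ⟨0, ?_⟩ ⟨L, hL⟩) h
  rintro _ ⟨_, rfl⟩
  exact hausdorffDist_nonneg

lemma tendsto_flatness_of_hasFDerivAt {n : ℕ} {f : EuclideanSpace ℝ (Fin n) → ℝ}
    (hf : Continuous f) {x g : EuclideanSpace ℝ (Fin n)} (hg : g ≠ 0)
    (hfg : HasFDerivAt f (innerSL ℝ g) x) (hx : f x = 0) :
    Tendsto (fun r => flatness {y | f y = 0} x r) (nhdsWithin 0 (Set.Ioi 0)) (nhds 0) := by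
  rw [Metric.tendsto_nhds]
  intro η hη
  obtain ⟨ε, hε0, hε⟩ := exists_between (lt_min one_pos (half_pos hη))
  have hε1 : ε < 1 := hε.trans_le (min_le_left _ _)
  have hεη : 2 * ε < η := by linarith [hε.trans_le (min_le_right 1 (η / 2))]
  have hg0 : 0 < ‖g‖ := norm_pos_iff.2 hg
  have ho := (hasFDerivAt_iff_isLittleO_nhds_zero.1 hfg).def
    (show 0 < ε * ‖g‖ / 2 by positivity)
  obtain ⟨δ, hδ, hball⟩ := Metric.eventually_nhds_iff.1 ho
  filter_upwards [Ioo_mem_nhdsGT hδ] with r hr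
  obtain ⟨hr0, hrδ⟩ := hr
  have happrox : ∀ u : EuclideanSpace ℝ (Fin n), ‖u‖ ≤ r →
      |f (x + u) - inner ℝ g u| ≤ ε * ‖g‖ / 2 * r := fun u hu => by
    have h := hball (y := u) (by rw [dist_zero_right]; linarith)
    rw [hx, sub_zero, innerSL_apply_apply, Real.norm_eq_abs] at h
    exact h.trans (by gcongr)
  obtain ⟨e, he⟩ : ∃ e : EuclideanSpace ℝ (Fin n), e = ‖g‖⁻¹ • g := ⟨_, rfl⟩
  have he1 : ‖e‖ = 1 := by rw [he]; exact norm_smul_inv_norm hg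
  have hge : inner ℝ g e = ‖g‖ := by
    rw [he, inner_smul_right, real_inner_self_eq_norm_sq]
    field_simp
  have hee : inner ℝ e e = (1 : ℝ) := by rw [real_inner_self_eq_norm_sq, he1, one_pow]
  have hgeq : g = ‖g‖ • e := by rw [he, smul_smul, mul_inv_cancel₀ hg0.ne', one_smul]
  have hginner : ∀ u, inner ℝ g u = ‖g‖ * inner ℝ e u := fun u => by
    conv_lhs => rw [hgeq]
    rw [real_inner_smul_left]
  rw [Real.dist_eq, sub_zero, abs_of_nonneg (flatness_nonneg _ _ hr0.le)]
  refine lt_of_le_of_lt ?_ hεη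
  refine flatness_le_of_hausdorffDist_le hr0 (finrank_orthogonal_span_singleton_eq hg) ?_
  refine hausdorffDist_le_of_mem_dist (by positivity) ?_ ?_
  · rintro y ⟨hy, hyr⟩
    obtain ⟨u, rfl⟩ : ∃ u, y = x + u := ⟨y - x, (add_sub_cancel x y).symm⟩
    rw [mem_closedBall, dist_self_add_left] at hyr
    have hfu : f (x + u) = 0 := hy
    have hu := happrox u hyr
    rw [hfu, zero_sub, abs_neg, hginner, abs_mul, abs_of_pos hg0] at hu
    have hu' : |inner ℝ e u| ≤ ε / 2 * r := by
      rw [← mul_le_mul_iff_right₀ hg0]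
      linarith
    have hperp : inner ℝ e (u - inner ℝ e u • e) = 0 := by
      rw [inner_sub_right, inner_smul_right, hee, mul_one, sub_self]
    refine ⟨x + (u - inner ℝ e u • e), ⟨⟨_, ?_, rfl⟩, ?_⟩, ?_⟩
    · rw [SetLike.mem_coe, Submodule.mem_orthogonal_singleton_iff_inner_right, hginner, hperp,
        mul_zero]
    · rw [mem_closedBall, dist_self_add_left]
      refine le_trans ?_ hyr
      refine abs_le_of_sq_le_sq' ?_ (norm_nonneg u) |>.2
      rw [norm_sub_sq_real, inner_smul_right, norm_smul, he1, real_inner_comm e u, mul_one,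
        Real.norm_eq_abs, sq_abs]
      nlinarith [sq_nonneg (inner ℝ e u : ℝ)]
    · rw [dist_add_left, dist_eq_norm, sub_sub_cancel, norm_smul, he1, mul_one,
        Real.norm_eq_abs]
      nlinarith [mul_pos hε0 hr0]
  · rintro _ ⟨⟨l, hl, rfl⟩, hlr⟩
    rw [mem_closedBall, dist_self_add_left] at hlr
    rw [SetLike.mem_coe, Submodule.mem_orthogonal_singleton_iff_inner_right] at hl
    have hnorm : ∀ s : ℝ, |s| ≤ ε * r → ‖(1 - ε) • l + s • e‖ ≤ r := fun s hs => by
      refine (norm_add_le _ _).trans ?_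
      rw [norm_smul, norm_smul, he1, Real.norm_of_nonneg (by linarith), Real.norm_eq_abs]
      nlinarith
    have hval : ∀ s : ℝ, inner ℝ g ((1 - ε) • l + s • e) = s * ‖g‖ := fun s => by
      rw [inner_add_right, inner_smul_right, inner_smul_right, hl, hge, mul_zero, zero_add]
    have hεr : 0 < ε * r := mul_pos hε0 hr0
    have hpos := happrox _ (hnorm (ε * r) (abs_of_pos hεr).le)
    have hneg := happrox _ (hnorm (-(ε * r)) (by rw [abs_neg, abs_of_pos hεr]))
    rw [hval, abs_le] at hpos hneg
    have hεrg : 0 < ε * r * ‖g‖ := mul_pos hεr hg0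
    have hcont : Continuous fun s : ℝ => f (x + ((1 - ε) • l + s • e)) :=
      hf.comp (by fun_prop)
    obtain ⟨s, ⟨hs0, hs1⟩, hs⟩ := intermediate_value_Icc
      (show -(ε * r) ≤ ε * r by linarith) hcont.continuousOn
      (show (0 : ℝ) ∈ Set.Icc _ _ from ⟨by nlinarith [hneg.2], by nlinarith [hpos.1]⟩)
    have hsabs : |s| ≤ ε * r := abs_le.2 ⟨hs0, hs1⟩
    refine ⟨x + ((1 - ε) • l + s • e), ⟨hs, ?_⟩, ?_⟩
    · rw [mem_closedBall, dist_self_add_left]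
      exact hnorm s hsabs
    · rw [dist_add_left, dist_eq_norm,
        show l - ((1 - ε) • l + s • e) = ε • l - s • e by module]
      refine (norm_sub_le _ _).trans ?_
      rw [norm_smul, norm_smul, he1, Real.norm_of_nonneg hε0.le, Real.norm_eq_abs]
      nlinarith

/-- Flat points of the zero set of a nonconstant harmonic polynomial are exactly the
regular points. -/
theorem flat_iff_regular {n : ℕ} (hn : 2 ≤ n) (h : MvPolynomial (Fin n) ℝ)
    (hharm : IsHarmonic h) (hnc : h.totalDegree ≠ 0)
    (x : EuclideanSpace ℝ (Fin n)) (hx : x ∈ zeroSet h) :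
    Filter.Tendsto (fun r => flatness (zeroSet h) x r)
      (nhdsWithin 0 (Set.Ioi 0)) (nhds 0) ↔ gradNeZero h x := by
  exact ⟨gradNeZero_of_tendsto_flatness (by omega) hharm hnc hx, fun hgrad =>
    tendsto_flatness_of_hasFDerivAt (continuous_evalPt h) (polyGradient_ne_zero hgrad)
      (hasFDerivAt_evalPt h x) hx⟩
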